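/- arXiv:2504.19877 — 14 statements merged into one kernel-verified Lean document; each statement's English description precedes it below -/
import Mathlib

section
/- Let M be a set, r a binary relation on M, and t : M × M → M such that r is semi-determined by t (r(x,y) implies t(x,y) = y). If r(x, t(t(x,y),z)) holds for all x, y, z ∈ M, then r is transitive. Conversely, if in addition r is strongly determined by t (i.e., also r(x, t(x,y)) holds for all x, y) and r is transitive, then r(x, t(t(x,y),z)) holds for all x, y, z ∈ M. -/
/-- If `r` is semi-determined by `t` and `r x (t (t x y) z)` holds for all
`x y z`, then `r` is transitive. Conversely, if `r` is strongly determined by `t`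
(in addition `r x (t x y)` holds) and `r` is transitive, then `r x (t (t x y) z)` holds
for all `x y z`. -/
theorem stmt1 {M : Type*} (r : M → M → Prop) (t : M → M → M)
    (semiDet : ∀ x y, r x y → t x y = y) :
    ((∀ x y z, r x (t (t x y) z)) → ∀ x y z, r x y → r y z → r x z) ∧
    ((∀ x y, r x (t x y)) → (∀ x y z, r x y → r y z → r x z) →
      ∀ x y z, r x (t (t x y) z)) := by
  refine ⟨fun h x y z hxy hyz => ?_, fun h htr x y z => htr _ _ _ (h x y) (h (t x y) z)⟩
  have h1 := h x y z
  rwa [semiDet x y hxy, semiDet y z hyz] at h1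
end

section
/- Let M be an M-algebra, i.e., a set with a binary operation → and a constant e satisfying Reflexivity (x → x = e), Unit-reduction (e → x = x), and the M-axiom ((((x → y) → y) → x) → ((((x → y) → y)) → z) = x → z for all x, y, z). Then the relation defined by a ≤ b iff a → b = e is semi-determined by the term t(x,y) = (x → y) → y (a ≤ b implies t(a,b) = b) and is a preorder on M: it is reflexive and transitive. -/
/-- In an M-algebra (Reflexivity `x → x = e`, Unit-reduction `e → x = x`,
M-axiom `(((x→y)→y)→x) → (((x→y)→y)→z) = x→z`), the relation `a ≤ b` (i.e. `a → b = e`)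
is semi-determined by `t(x,y) = (x→y)→y` and is a preorder (reflexive and transitive). -/
theorem stmt3 {M : Type*} (imp : M → M → M) (e : M)
    (refl : ∀ x, imp x x = e)
    (unitRed : ∀ x, imp e x = x)
    (mAxiom : ∀ x y z,
      imp (imp (imp (imp x y) y) x) (imp (imp (imp x y) y) z) = imp x z) :
    (∀ a b, imp a b = e → imp (imp a b) b = b) ∧
    (∀ a, imp a a = e) ∧
    (∀ a b c, imp a b = e → imp b c = e → imp a c = e) := by
  refine ⟨fun a b h => by rw [h, unitRed], refl, fun a b c hab hbc => ?_⟩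
  have h1 := mAxiom a b b
  have h2 := mAxiom a b c
  rw [hab, unitRed, refl] at h1
  rw [hab, unitRed, hbc] at h2
  exact h2.symm.trans h1
end

section
/- Let M be an M-algebra satisfying in addition Implicative commutativity (x → (y → z) = y → (x → z)) and such that → is increasing in its second component (b ≤ c implies (a → b) ≤ (a → c)). Write t(x,y) = (x → y) → y and x̄ = t(x,y). Then t is a relative closure term on M, i.e., for all x, y, z ∈ M: Left-absorption t(x, x̄) = x̄; Right-absorption t(x̄, y) ≤ x̄; Left-monotonicity t(x,z) ≤ t(x̄, z); Flattening t(x̄, t(x,z)) = t(x̄, z); and Closure stability t(t(x̿, x̄), x) ≤ t(x̿, x), where x̿ = t(x̄, z) and a ≤ b abbreviates t(a,b) = b. -/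
/-- In an M-algebra satisfying Implicative commutativity and with `→`
increasing in its second component, the term `t(x,y) = (x→y)→y` is a relative closure
term: writing `x̄ = t(x,y)`, `x̿ = t(x̄,z)`, and `a ≤ b` for `t(a,b) = b`, we have
Left-absorption `t(x,x̄) = x̄`, Right-absorption `t(x̄,y) ≤ x̄`, Left-monotonicity
`t(x,z) ≤ t(x̄,z)`, Flattening `t(x̄,t(x,z)) = t(x̄,z)`, and Closure stability
`t(t(x̿,x̄),x) ≤ t(x̿,x)`. -/
theorem stmt5 {M : Type*} (imp : M → M → M) (e : M)
    (refl : ∀ x, imp x x = e)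
    (unitRed : ∀ x, imp e x = x)
    (mAxiom : ∀ x y z,
      imp (imp (imp (imp x y) y) x) (imp (imp (imp x y) y) z) = imp x z)
    (impComm : ∀ x y z, imp x (imp y z) = imp y (imp x z))
    (incr : ∀ a b c, imp b c = e → imp (imp a b) (imp a c) = e)
    (t : M → M → M) (ht : ∀ x y, t x y = imp (imp x y) y) :
    ∀ x y z,
      (t x (t x y) = t x y) ∧
      (t (t (t x y) y) (t x y) = t x y) ∧
      (t (t x z) (t (t x y) z) = t (t x y) z) ∧
      (t (t x y) (t x z) = t (t x y) z) ∧
      (t (t (t (t (t x y) z) (t x y)) x) (t (t (t x y) z) x)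
        = t (t (t x y) z) x) := by
  have le_t : ∀ x y, imp x (imp (imp x y) y) = e := by
    intro x y
    rw [impComm, refl]
  have t_of_le : ∀ a b, imp a b = e → imp (imp a b) b = b := by
    intro a b h
    rw [h, unitRed]
  -- the M-axiom for comparable elements
  have mle : ∀ a b w, imp a b = e → imp (imp b a) (imp b w) = imp a w := by
    intro a b w h
    have := mAxiom a b w
    rwa [t_of_le a b h] at this
  have trans : ∀ a b c, imp a b = e → imp b c = e → imp a c = e := by
    intro a b c h1 h2
    have := incr a b c h2
    rwa [h1, unitRed] at this
  have anti : ∀ b c w, imp b c = e → imp (imp c w) (imp b w) = e := by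
    intro b c w h
    have h1 := mle b c c h
    rw [refl, h] at h1
    rw [← mle b c w h, impComm, refl, h1]
  have equivl : ∀ p q w, imp p q = e → imp q p = e → imp q w = imp p w := by
    intro p q w h1 h2
    have := mle p q w h1
    rwa [h2, unitRed] at this
  intro x y z
  simp only [ht]
  refine ⟨t_of_le _ _ (le_t x y), t_of_le _ _ ?_, t_of_le _ _ ?_, ?_, t_of_le _ _ ?_⟩
  · exact anti _ _ _ (le_t (imp x y) y)
  · exact anti _ _ _ (anti _ _ _ (le_t x y))
  · have huv := anti _ _ z (le_t x y)
    rw [impComm (imp (imp x y) y) (imp x z) z, mle _ _ z huv]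
  · have hxa := le_t x y
    generalize imp (imp x y) y = a at *
    have hab := le_t a z
    generalize imp (imp a z) z = b at *
    apply anti
    have hbt := le_t b a
    have hc : ∀ w, imp (imp (imp (imp b a) a) a) w = imp (imp b a) w := by
      intro w
      exact equivl _ _ w (le_t (imp b a) a) (anti _ _ a hbt)
    have hat : imp a (imp (imp b a) a) = e := trans _ _ _ hab hbt
    have h1 := mle a _ x hat
    rw [hc] at h1
    have huc := incr b x a hxa
    have h2 := mle _ _ (imp (imp (imp b a) a) x) huc
    rw [mle a b x hab, h1, refl] at h2
    exact h2.symm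
end

section
/- Let M be a set with a binary operation t that is a weak relative closure term, i.e., writing a ≤ b for t(a,b) = b, for all x, y, z ∈ M: Right-absorption t(t(t(x,y),y), t(x,y)) = t(x,y); Flattening t(t(x,y), t(x,z)) = t(t(x,y), z); and Weak closure stability t(t(t(X, x̄), x), t(X, x)) = t(X, x), where x̄ = t(x,y) and X = t(t(x,y), x). Then the relation ≤ is anti-symmetric (t(a,b) = b and t(b,a) = a imply a = b) if and only if t(t(x,y), x) = t(t(t(x,y), x), y) holds for all x, y ∈ M. -/
/-- Let `t` be a weak relative closure term on `M`: Right-absorption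
`t (t (t x y) y) (t x y) = t x y`, Flattening `t (t x y) (t x z) = t (t x y) z`, and
Weak closure stability `t (t (t X x̄) x) (t X x) = t X x` where `x̄ = t x y` and
`X = t (t x y) x`. Then the relation `a ≤ b ↔ t a b = b` is anti-symmetric iff
`t (t x y) x = t (t (t x y) x) y` holds for all `x, y`. -/
theorem stmt6 {M : Type*} (t : M → M → M)
    (rightAbs : ∀ x y, t (t (t x y) y) (t x y) = t x y)
    (flat : ∀ x y z, t (t x y) (t x z) = t (t x y) z)
    (weakClosure : ∀ x y,
      t (t (t (t (t x y) x) (t x y)) x) (t (t (t x y) x) x) = t (t (t x y) x) x) :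
    (∀ a b, t a b = b → t b a = a → a = b) ↔
      (∀ x y, t (t x y) x = t (t (t x y) x) y) := by
  constructor
  · intro anti x y
    have e1 : ∀ x y, t (t x y) (t x y) = t (t x y) y := fun x y => flat x y y
    have r : ∀ x y, t (t (t x y) (t x y)) (t x y) = t x y := by
      intro x y
      rw [e1]
      exact rightAbs x y
    -- elements of the image are idempotent
    have idem : ∀ x y, t (t x y) (t x y) = t x y := by
      intro x y
      have h1 := r x y
      generalize t x y = a at h1 ⊢
      have h2 := flat a a a
      have h3 := r a a
      rw [h2, h1] at h3
      exact anti _ _ h1 h3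
    have abs : ∀ x y, t (t x y) y = t x y := by
      intro x y
      rw [← e1, idem]
    have w := weakClosure x y
    have hX : t (t (t x y) x) (t x y) = t (t (t x y) x) y := by
      have h := flat (t x y) x y
      rwa [abs x y] at h
    have hXX := idem (t x y) x
    have hXx := abs (t x y) x
    rw [hX, hXx] at w
    generalize t (t x y) x = X at *
    have h4 := flat X y x
    rw [hXx] at h4
    rw [← h4, abs] at w
    have h5 := flat X X y
    rw [hXX] at h5
    exact anti _ _ h5 w
  · intro h a b hab hba
    have := h a b
    rw [hab, hba, hab] at this
    exact this
end

section
/- Let M be a set with a binary operation t that is a weak relative closure term (Right-absorption, Flattening, Weak closure stability), satisfying also t(t(x,y), x) = t(t(t(x,y), x), y) for all x, y ∈ M and the Modus-ponens-style law y ≤ t(x,y), i.e., t(y, t(x,y)) = t(x,y) for all x, y ∈ M. Then the Cornish condition J holds in M: t(t(x,y), x) = t(t(y,x), y) for all x, y ∈ M. -/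
/-- Let `t` be a weak relative closure term on `M` (Right-absorption,
Flattening, Weak closure stability) satisfying also `t (t x y) x = t (t (t x y) x) y`
and the Modus-ponens-style law `t y (t x y) = t x y` for all `x, y`. Then the
Cornish condition J holds: `t (t x y) x = t (t y x) y` for all `x, y`. -/
theorem stmt7 {M : Type*} (t : M → M → M)
    (rightAbs : ∀ x y, t (t (t x y) y) (t x y) = t x y)
    (flat : ∀ x y z, t (t x y) (t x z) = t (t x y) z)
    (weakClosure : ∀ x y,
      t (t (t (t (t x y) x) (t x y)) x) (t (t (t x y) x) x) = t (t (t x y) x) x)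
    (tantisymm : ∀ x y, t (t x y) x = t (t (t x y) x) y)
    (mp : ∀ x y, t y (t x y) = t x y) :
    ∀ x y, t (t x y) x = t (t y x) y := by
  have idem : ∀ x y, t (t x y) (t x y) = t x y := by
    intro x y
    have h1 : t (t (t x y) (t x y)) (t x y) = t x y := by
      have h := rightAbs x y
      rwa [← flat x y y] at h
    have h2 := tantisymm (t x y) (t x y)
    rw [h1] at h2
    exact h2.symm
  have rid : ∀ x y, t (t x y) y = t x y := fun x y => by rw [← flat x y y, idem]
  have F2 : ∀ x y z, t (t x y) (t y z) = t (t x y) z := by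
    intro x y z
    have h := flat y (t x y) z
    rwa [mp] at h
  have hX : ∀ x y, t (t x y) (t y x) = t (t x y) x := fun x y => F2 x y x
  have hp : ∀ x y, t (t (t x y) x) (t x y) = t (t x y) x := by
    intro x y
    have h := flat (t x y) x y
    rw [rid x y, ← tantisymm x y] at h
    exact h
  have hXY : ∀ x y, t (t (t x y) x) (t (t y x) y) = t (t x y) x := by
    intro x y
    have h := F2 (t x y) (t y x) (t x y)
    rw [hX x y, hX y x, hp] at h
    exact h
  intro x y
  have h := mp (t (t x y) x) (t (t y x) y)
  rw [hXY x y, hXY y x] at h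
  exact h.symm
end

section
/- Let M be an MC-algebra, i.e., an M-algebra satisfying Implicative commutativity (x → (y → z) = y → (x → z)) and such that → is increasing in its second component (b ≤ c implies (a → b) ≤ (a → c)). Write T(x,y) = (x → y) → y. Then the relation ≤ is anti-symmetric (a → b = e and b → a = e imply a = b) if and only if M satisfies the equation T(T(x,y), x) = T(T(T(x,y), x), y) for all x, y ∈ M. (This shows the quasi-variety of MC-algebras, equivalently MBC-algebras, forms a variety.) -/
/-- Let `M` be an MC-algebra: an M-algebra satisfying Implicative
commutativity and with `→` increasing in its second component. Write
`T(x,y) = (x→y)→y`. Then the relation `a ≤ b ↔ a → b = e` is anti-symmetric iff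
`T (T x y) x = T (T (T x y) x) y` holds for all `x, y`. -/
theorem stmt8 {M : Type*} (imp : M → M → M) (e : M)
    (refl : ∀ x, imp x x = e)
    (unitRed : ∀ x, imp e x = x)
    (mAxiom : ∀ x y z,
      imp (imp (imp (imp x y) y) x) (imp (imp (imp x y) y) z) = imp x z)
    (impComm : ∀ x y z, imp x (imp y z) = imp y (imp x z))
    (incr : ∀ a b c, imp b c = e → imp (imp a b) (imp a c) = e)
    (T : M → M → M) (hT : ∀ x y, T x y = imp (imp x y) y) :
    (∀ a b, imp a b = e → imp b a = e → a = b) ↔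
      (∀ x y, T (T x y) x = T (T (T x y) x) y) := by
  constructor
  · intro anti
    -- divisibility: if `b ≤ w` then `w → b` composed with `w` acts as `b`
    have H : ∀ b w, imp b w = e → ∀ z, imp (imp w b) (imp w z) = imp b z := by
      intro b w hbw z
      have h := mAxiom b w z
      rwa [hbw, unitRed] at h
    have leT : ∀ x y, imp x (imp (imp x y) y) = e := fun x y => by
      rw [impComm, refl]
    have trans : ∀ a b c, imp a b = e → imp b c = e → imp a c = e := by
      intro a b c h1 h2
      have h := incr a b c h2
      rwa [h1, unitRed] at h
    have antit : ∀ a b c, imp a b = e → imp (imp b c) (imp a c) = e := by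
      intro a b c h
      rw [impComm]
      exact trans _ _ _ h (leT b c)
    have triple : ∀ x y, imp (imp (imp x y) y) y = imp x y := fun x y =>
      anti _ _ (antit _ _ y (leT x y)) (leT _ _)
    intro x y
    simp only [hT]
    obtain ⟨a, ha⟩ : ∃ a, a = imp x y := ⟨_, rfl⟩
    obtain ⟨t, ht⟩ : ∃ t, t = imp a y := ⟨_, rfl⟩
    obtain ⟨d, hd⟩ : ∃ d, d = imp t x := ⟨_, rfl⟩
    obtain ⟨s, hs⟩ : ∃ s, s = imp d x := ⟨_, rfl⟩
    obtain ⟨q, hq⟩ : ∃ q, q = imp s y := ⟨_, rfl⟩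
    obtain ⟨r, hr⟩ : ∃ r, r = imp q y := ⟨_, rfl⟩
    obtain ⟨h, hh⟩ : ∃ h, h = imp s t := ⟨_, rfl⟩
    obtain ⟨g, hg⟩ : ∃ g, g = imp r s := ⟨_, rfl⟩
    obtain ⟨p, hp⟩ : ∃ p, p = imp r x := ⟨_, rfl⟩
    rw [← ha, ← ht, ← hd, ← hs, ← hq, ← hr]
    have xt : imp x t = e := by rw [ht, ha]; exact leT _ _
    have ts : imp t s = e := by rw [hs, hd]; exact leT _ _
    have sr : imp s r = e := by rw [hr, hq]; exact leT _ _
    have xs := trans _ _ _ xt ts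
    have tr := trans _ _ _ ts sr
    have sx : imp s x = d := by rw [hs, hd]; exact triple _ _
    have ry : imp r y = q := by rw [hr, hq]; exact triple _ _
    have rt : imp r t = h := by rw [hh, ht, impComm r, impComm s, ry, hq]
    have dh : imp d h = e := by
      have := H x s xs t
      rwa [sx, ← hh, xt] at this
    have hd' : imp h d = d := by
      have := H t s ts x
      rwa [sx, ← hh, ← hd] at this
    have Lhd : ∀ z, imp h (imp d z) = imp d z := by
      intro z
      have := H d h dh z
      rwa [hd', impComm] at this
    have hg' : imp h g = e := by
      have := H t r tr s
      rwa [rt, ← hg, ts] at this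
    have gh : imp g h = h := by
      have := H s r sr t
      rwa [rt, ← hg, ← hh] at this
    have Lgh : ∀ z, imp g (imp h z) = imp h z := by
      intro z
      have := H h g hg' z
      rwa [gh, impComm] at this
    have pd : imp p d = e := by
      rw [hp, ← sx]; exact antit _ _ _ sr
    have dp : imp d p = g := by rw [hp, impComm, ← hs, hg]
    have Lp : ∀ z, imp p z = imp d z := by
      intro z
      have := H p d pd z
      rw [dp] at this
      rw [← this, ← Lhd z, Lgh]
    have rs : imp r s = e := by rw [← hg, ← dp, ← Lp, refl]
    exact anti _ _ sr rs
  · intro h a b hab hba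
    have := h a b
    simpa only [hT, hab, hba, unitRed] using this
end

section
/- Let M be a set with a partial order ≤ and let p : M × M × M → M be monotone in each argument (a₁ ≤ a₂, b₁ ≤ b₂, c₁ ≤ c₂ imply p(a₁,b₁,c₁) ≤ p(a₂,b₂,c₂)) and satisfy the Malcev identities p(x,y,y) = x and p(x,x,y) = y for all x, y ∈ M. Then the order ≤ is discrete: a ≤ b implies a = b for all a, b ∈ M. -/
/-- If `M` is a partial order with a ternary operation `p` that is
monotone in each argument and satisfies the Malcev identities `p x y y = x` and
`p x x y = y`, then the order is discrete: `a ≤ b → a = b`. -/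
theorem stmt9 {M : Type*} [PartialOrder M] (p : M → M → M → M)
    (mono : ∀ a₁ a₂ b₁ b₂ c₁ c₂ : M,
      a₁ ≤ a₂ → b₁ ≤ b₂ → c₁ ≤ c₂ → p a₁ b₁ c₁ ≤ p a₂ b₂ c₂)
    (malcev₁ : ∀ x y : M, p x y y = x)
    (malcev₂ : ∀ x y : M, p x x y = y) :
    ∀ a b : M, a ≤ b → a = b := by
  intro a b hab
  have h := mono a a a b b b le_rfl hab le_rfl
  rw [malcev₂, malcev₁] at h
  exact le_antisymm hab h
end

section
/- Let L be a first-order language and M a nonempty L-structure carrying a partial order ≤ such that: (i) for every function symbol f of L of positive arity n, there exists an index i < n with v(i) ≤ fᴹ(v) for all v : Fin n → M (each structure map is inflationary in some component); and (ii) for every constant symbol c of L, the interpretation cᴹ is a maximum element of M (a ≤ cᴹ for all a ∈ M). If there exists an L-term p in three variables whose realization in M satisfies the Malcev identities p(x,y,y) = x and p(x,x,y) = y for all x, y ∈ M, then M has at most one element. -/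
open FirstOrder

/-- Let `M` be a nonempty `L`-structure with a partial order such that
every function symbol of positive arity is inflationary in some component and every
constant symbol is interpreted as a maximum element. If some `L`-term `p` in three
variables realizes the Malcev identities in `M`, then `M` has at most one element. -/
theorem stmt10 {L : Language} {M : Type*} [Nonempty M] [L.Structure M]
    [PartialOrder M]
    (hinfl : ∀ {n : ℕ} (f : L.Functions (n + 1)),
      ∃ i : Fin (n + 1), ∀ v : Fin (n + 1) → M, v i ≤ Language.Structure.funMap f v)
    (hconst : ∀ (c : L.Constants) (a : M), a ≤ (c : M))
    (p : L.Term (Fin 3))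
    (malcev₁ : ∀ x y : M, p.realize ![x, y, y] = x)
    (malcev₂ : ∀ x y : M, p.realize ![x, x, y] = y) :
    ∀ a b : M, a = b := by
  have key : ∀ t : L.Term (Fin 3), ∃ j : Fin 3, ∀ v : Fin 3 → M, v j ≤ t.realize v := by
    intro t
    induction t with
    | var j => exact ⟨j, fun v => le_rfl⟩
    | @func n f ts ih =>
      cases n with
      | zero =>
        refine ⟨0, fun v => ?_⟩
        have h := hconst f (v 0)
        have e : ((f : L.Constants) : M) = Language.Structure.funMap f
            (fun i => (ts i).realize v) := by
          change Language.Structure.funMap f _ = _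
          congr 1
          exact Subsingleton.elim _ _
        rw [e] at h
        exact h
      | succ n =>
        obtain ⟨i, hi⟩ := hinfl f
        obtain ⟨j, hj⟩ := ih i
        exact ⟨j, fun v => (hj v).trans (hi fun k => (ts k).realize v)⟩
  obtain ⟨j, hj⟩ := key p
  have le_all : ∀ x y : M, x ≤ y := by
    intro x y
    fin_cases j
    · have h := hj ![x, x, y]
      rw [malcev₂] at h
      exact h
    · have h := hj ![y, x, x]
      rw [malcev₁] at h
      exact h
    · have h := hj ![y, x, x]
      rw [malcev₁] at h
      exact h
  exact fun a b => le_antisymm (le_all a b) (le_all b a)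
end

section
/- Let L be a first-order language and M a nonempty L-structure carrying a partial order ≤ such that: (i) for every function symbol f of L of positive arity n, there exists an index i < n with v(i) ≤ fᴹ(v) for all v : Fin n → M; and (ii) for every constant symbol c of L, the interpretation cᴹ is not a least element of M (it is not the case that cᴹ ≤ a for all a ∈ M). Suppose there exist n ∈ ℕ, an L-term θ in n+1 variables, L-terms θ₁, …, θₙ each in two variables, and closed L-terms t₁, …, tₙ such that for all x, y ∈ M: the realization of θᵢ at (x,x) equals the realization of tᵢ for each i ≤ n, and the realization of θ at (y, θ₁(x,y), …, θₙ(x,y)) equals x. Then M has at most one element. -/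
open FirstOrder

theorem term_infl {L : Language} {M : Type*} [L.Structure M] [PartialOrder M]
    (hinfl : ∀ {m : ℕ} (f : L.Functions (m + 1)),
      ∃ i : Fin (m + 1), ∀ v : Fin (m + 1) → M, v i ≤ Language.Structure.funMap f v)
    {α : Type*} (t : L.Term α) :
    (∃ i : α, ∀ v : α → M, v i ≤ t.realize v) ∨
      (∃ c : L.Constants, ∀ v : α → M, (c : M) ≤ t.realize v) := by
  induction t with
  | var i => exact Or.inl ⟨i, fun v => le_refl _⟩
  | @func l f ts ih =>
    cases l with
    | zero =>
      refine Or.inr ⟨f, fun v => le_of_eq ?_⟩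
      change Language.Structure.funMap f default = Language.Structure.funMap f _
      congr 1
      exact Subsingleton.elim _ _
    | succ m =>
      obtain ⟨i, hi⟩ := hinfl f
      rcases ih i with ⟨j, hj⟩ | ⟨c, hc⟩
      · exact Or.inl ⟨j, fun v => (hj v).trans (hi fun k => (ts k).realize v)⟩
      · exact Or.inr ⟨c, fun v => (hc v).trans (hi fun k => (ts k).realize v)⟩

/-- Let `M` be a nonempty `L`-structure with a partial order such that
every function symbol of positive arity is inflationary in some component and no
constant symbol is interpreted as a least element. If `M` admits protomodular terms
`θ, θ₁, …, θₙ, t₁, …, tₙ` (with `θᵢ(x,x) = tᵢ` and `θ(y, θ₁(x,y), …, θₙ(x,y)) = x`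
in `M`), then `M` has at most one element. -/
theorem stmt11 {L : Language} {M : Type*} [Nonempty M] [L.Structure M]
    [PartialOrder M]
    (hinfl : ∀ {m : ℕ} (f : L.Functions (m + 1)),
      ∃ i : Fin (m + 1), ∀ v : Fin (m + 1) → M, v i ≤ Language.Structure.funMap f v)
    (hconst : ∀ c : L.Constants, ¬ ∀ a : M, (c : M) ≤ a)
    (n : ℕ) (θ : L.Term (Fin (n + 1))) (θs : Fin n → L.Term (Fin 2))
    (ts : Fin n → L.Term Empty)
    (hθs : ∀ (i : Fin n) (x : M),
      (θs i).realize ![x, x] = (ts i).realize (Empty.elim : Empty → M))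
    (hθ : ∀ x y : M,
      θ.realize (Fin.cases y (fun i => (θs i).realize ![x, y])) = x) :
    ∀ a b : M, a = b := by
  intro a b
  rcases term_infl (M := M) hinfl θ with ⟨i, hi⟩ | ⟨c, hc⟩
  · have key : ∀ x y : M, (Fin.cases y (fun i => (θs i).realize ![x, y]) : Fin (n + 1) → M) i ≤ x :=
      fun x y => (hi _).trans (hθ x y).le
    induction i using Fin.cases with
    | zero => exact le_antisymm (key b a) (key a b)
    | succ k =>
      have key' : ∀ x y : M, (θs k).realize ![x, y] ≤ x := key
      rcases term_infl (M := M) hinfl (θs k) with ⟨j, hj⟩ | ⟨c, hc⟩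
      · fin_cases j
        · have e : ∀ x : M, x = (ts k).realize (Empty.elim : Empty → M) := fun x =>
            (le_antisymm (hj ![x, x]) (key' x x)).trans (hθs k x)
          exact (e a).trans (e b).symm
        · exact le_antisymm ((hj ![b, a]).trans (key' b a)) ((hj ![a, b]).trans (key' a b))
      · exact absurd (fun x => (hc ![x, x]).trans (key' x x)) (hconst c)
  · exact absurd (fun x => (hc _).trans (hθ x x).le) (hconst c)
end

section
/- Let M be a Johnstone algebra satisfying Residuation (x → (y → z) = (y * x) → z for all x, y, z). Then the relation ≤ (a ≤ b iff a → b = e) is a partial order on M, and (M, *, e) is a monoid: * is associative and e is a two-sided identity ((x * y) * z = x * (y * z), x * e = x, and e * x = x for all x, y, z). -/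
/-- A Johnstone algebra satisfying Residuation
(`x → (y → z) = (y * x) → z`) is a poset under `a ≤ b ↔ a → b = e`, and `(M, *, e)`
is a monoid: `*` is associative and `e` is a two-sided identity. -/
theorem stmt14 {M : Type*} (mul imp : M → M → M) (e : M)
    (refl : ∀ x, imp x x = e)
    (unitRed : ∀ x, imp e x = x)
    (monoDiv : ∀ x y, mul (imp (imp x y) y) (imp (imp (imp x y) y) x) = x)
    (residuation : ∀ x y z, imp x (imp y z) = imp (mul y x) z) :
    ((∀ a, imp a a = e) ∧
     (∀ a b, imp a b = e → imp b a = e → a = b) ∧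
     (∀ a b c, imp a b = e → imp b c = e → imp a c = e)) ∧
    ((∀ x y z, mul (mul x y) z = mul x (mul y z)) ∧
     (∀ x, mul x e = x) ∧
     (∀ x, mul e x = x)) := by
  have me : ∀ x, mul x e = x := fun x => by
    have h := monoDiv x x
    rwa [refl, unitRed, refl] at h
  have key : ∀ a b, imp a b = e → mul b (imp b a) = a := fun a b h => by
    have h' := monoDiv a b
    rwa [h, unitRed] at h'
  have anti : ∀ a b, imp a b = e → imp b a = e → a = b := fun a b h h' => by
    have k := key a b h
    rw [h', me] at k
    exact k.symm
  have ext : ∀ a b, (∀ w, imp a w = imp b w) → a = b := fun a b h =>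
    anti a b (by rw [h, refl]) (by rw [← h, refl])
  refine ⟨⟨refl, anti, ?_⟩, ?_, me, ?_⟩
  · intro a b c hab hbc
    have k := key a b hab
    calc imp a c = imp (mul b (imp b a)) c := by rw [k]
      _ = imp (imp b a) (imp b b) := by rw [← residuation, hbc, refl]
      _ = imp a b := by rw [residuation, k]
      _ = e := hab
  · intro x y z
    apply ext
    intro w
    simp only [← residuation]
  · intro x
    apply ext
    intro w
    rw [← residuation, unitRed]
end

section
/- Let M be a left loop, i.e., a set with binary operations * and → and a constant e satisfying x * (x → y) = y, x → (x * y) = y, x * e = x, and e * x = x for all x, y. If M satisfies Residuation (x → (y → z) = (y * x) → z for all x, y, z), then * is associative, so M is a group. Conversely, every group, with x → y defined as x⁻¹ * y, is a left loop satisfying Residuation. -/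
/-- A left loop (`x * (x → y) = y`, `x → (x * y) = y`, `x * e = x`,
`e * x = x`) satisfying Residuation (`x → (y → z) = (y * x) → z`) has associative
multiplication, hence is a group. Conversely, every group, with `x → y := x⁻¹ * y`,
is a left loop satisfying Residuation. -/
theorem stmt15 :
    (∀ (M : Type*) (mul imp : M → M → M) (e : M),
      (∀ x y, mul x (imp x y) = y) →
      (∀ x y, imp x (mul x y) = y) →
      (∀ x, mul x e = x) →
      (∀ x, mul e x = x) →
      (∀ x y z, imp x (imp y z) = imp (mul y x) z) →
      ∀ x y z, mul (mul x y) z = mul x (mul y z)) ∧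
    (∀ (G : Type*) [Group G],
      (∀ x y : G, x * (x⁻¹ * y) = y) ∧
      (∀ x y : G, x⁻¹ * (x * y) = y) ∧
      (∀ x : G, x * 1 = x) ∧
      (∀ x : G, 1 * x = x) ∧
      (∀ x y z : G, x⁻¹ * (y⁻¹ * z) = (y * x)⁻¹ * z)) := by
  refine ⟨?_, ?_⟩
  · intro M mul imp e hl hu _ _ hr x y z
    have h : imp (mul x y) (mul x (mul y z)) = z := by
      rw [← hr, hu, hu]
    have h2 := hl (mul x y) (mul x (mul y z))
    rw [h] at h2
    exact h2
  · intro G _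
    refine ⟨?_, ?_, ?_, ?_, ?_⟩ <;> intros <;> simp [mul_assoc]
end

section
/- Let M be a Johnstone algebra satisfying Compositionality ((x → y) → ((z → x) → (z → y)) = e for all x, y, z). Then the relation ≤ (a ≤ b iff a → b = e) is a partial order on M (in particular transitive), and → is increasing in its second argument: b ≤ c implies (a → b) ≤ (a → c) for all a, b, c. Moreover, a left loop satisfying Compositionality satisfies Residuation and hence is a group. -/
/-- A Johnstone algebra satisfying Compositionality
(`(x→y) → ((z→x) → (z→y)) = e`) is a poset under `a ≤ b ↔ a → b = e` (in particular
`≤` is transitive), and `→` is increasing in its second argument. Moreover, a left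
loop satisfying Compositionality satisfies Residuation and hence is a group
(its multiplication is associative). -/
theorem stmt16 {M : Type*} (mul imp : M → M → M) (e : M)
    (refl : ∀ x, imp x x = e)
    (unitRed : ∀ x, imp e x = x)
    (monoDiv : ∀ x y, mul (imp (imp x y) y) (imp (imp (imp x y) y) x) = x)
    (comp : ∀ x y z, imp (imp x y) (imp (imp z x) (imp z y)) = e) :
    ((∀ a, imp a a = e) ∧
     (∀ a b, imp a b = e → imp b a = e → a = b) ∧
     (∀ a b c, imp a b = e → imp b c = e → imp a c = e)) ∧
    (∀ a b c, imp b c = e → imp (imp a b) (imp a c) = e) ∧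
    (∀ (N : Type*) (mul' imp' : N → N → N) (e' : N),
      (∀ x y, mul' x (imp' x y) = y) →
      (∀ x y, imp' x (mul' x y) = y) →
      (∀ x, mul' x e' = x) →
      (∀ x, mul' e' x = x) →
      (∀ x y z, imp' (imp' x y) (imp' (imp' z x) (imp' z y)) = e') →
      ((∀ x y z, imp' x (imp' y z) = imp' (mul' y x) z) ∧
       (∀ x y z, mul' (mul' x y) z = mul' x (mul' y z)))) := by
  have me : ∀ x, mul x e = x := by
    intro x
    have h := monoDiv x x
    simpa only [refl, unitRed] using h
  have mono : ∀ a b c, imp b c = e → imp (imp a b) (imp a c) = e := by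
    intro a b c h
    have h1 := comp b c a
    rwa [h, unitRed] at h1
  refine ⟨⟨refl, ?_, ?_⟩, mono, ?_⟩
  · intro a b h1 h2
    have h := monoDiv a b
    rw [h1, unitRed, h2, me] at h
    exact h.symm
  · intro a b c h1 h2
    have h := mono a b c h2
    rwa [h1, unitRed] at h
  · intro N m i e' h1 h2 h3 h4 h5
    have eqOf : ∀ x y, i x y = e' → y = x := by
      intro x y h
      have := h1 x y
      rw [h, h3] at this
      exact this.symm
    have res : ∀ x y z, i x (i y z) = i (m y x) z := by
      intro x y z
      have h := eqOf _ _ (h5 (m y x) z y)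
      rwa [h2] at h
    refine ⟨res, ?_⟩
    intro x y z
    have h := res y x (m (m x y) z)
    rw [h2] at h
    have k : m y z = i x (m (m x y) z) := by
      have := h1 y (i x (m (m x y) z))
      rwa [h] at this
    rw [k, h1]
end

section
/- Let M be a Johnstone algebra satisfying both Residuation (x → (y → z) = (y * x) → z) and Compositionality ((x → y) → ((z → x) → (z → y)) = e). Then for each x ∈ M the maps x * (−) and x → (−) form a Galois connection with respect to the partial order ≤: for all x, y, z ∈ M, x * y ≤ z if and only if y ≤ x → z. Consequently, * is increasing in its right argument: y ≤ z implies x * y ≤ x * z. -/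
/-- In a Johnstone algebra satisfying Residuation and Compositionality,
for each `x` the maps `x * (−)` and `x → (−)` form a Galois connection w.r.t.
`a ≤ b ↔ a → b = e`: `x * y ≤ z ↔ y ≤ x → z`. Consequently `*` is increasing in its
right argument. -/
theorem stmt17 {M : Type*} (mul imp : M → M → M) (e : M)
    (refl : ∀ x, imp x x = e)
    (unitRed : ∀ x, imp e x = x)
    (monoDiv : ∀ x y, mul (imp (imp x y) y) (imp (imp (imp x y) y) x) = x)
    (residuation : ∀ x y z, imp x (imp y z) = imp (mul y x) z)
    (comp : ∀ x y z, imp (imp x y) (imp (imp z x) (imp z y)) = e) :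
    (∀ x y z, imp (mul x y) z = e ↔ imp y (imp x z) = e) ∧
    (∀ x y z, imp y z = e → imp (mul x y) (mul x z) = e) := by
  refine ⟨fun x y z => by rw [residuation], fun x y z h => ?_⟩
  have h1 : imp z (imp x (mul x z)) = e := by rw [residuation, refl]
  have h2 := comp z (imp x (mul x z)) y
  rw [h1, h, unitRed, unitRed, residuation] at h2
  exact h2
end

section
/- Every hoop satisfies Monotone division: in any hoop M, ((x → y) → y) * (((x → y) → y) → x) = x for all x, y ∈ M. Hence every hoop is a Johnstone algebra. -/
/-- Every hoop (a commutative monoid `(M, *, e)` with `→` satisfying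
Reflexivity, Unit-reduction, Hoop-symmetry and Residuation) satisfies Monotone
division: `((x→y)→y) * (((x→y)→y) → x) = x`. Hence every hoop is a Johnstone
algebra. -/
theorem stmt18 {M : Type*} (mul imp : M → M → M) (e : M)
    (assoc : ∀ x y z, mul (mul x y) z = mul x (mul y z))
    (comm : ∀ x y, mul x y = mul y x)
    (rightId : ∀ x, mul x e = x)
    (leftId : ∀ x, mul e x = x)
    (refl : ∀ x, imp x x = e)
    (unitRed : ∀ x, imp e x = x)
    (hoopSymm : ∀ x y, mul x (imp x y) = mul y (imp y x))
    (residuation : ∀ x y z, imp x (imp y z) = imp (mul y x) z) :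
    ∀ x y, mul (imp (imp x y) y) (imp (imp (imp x y) y) x) = x := by
  intro x y
  rw [hoopSymm, residuation, comm (imp x y) x, ← residuation, refl, rightId]
end
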